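/- arXiv:1005.3212 — 2 statements merged into one kernel-verified Lean document; each statement's English description precedes it below -/
import Mathlib

section
/- Let E be a finite-dimensional real inner product space, and let A and B be finite sets of linear functionals on E, with B nonempty. Define C = {v ∈ E : α(v) ≥ 0 for all α ∈ A}, assume C contains a nonzero vector, and let M be the maximum value of the function v ↦ (min_{β∈B} β(v)) / ‖v‖ on C \ {0}. If M > 0, then the set of maximizers is a single ray: there exists v₀ ∈ C \ {0} with (min_{β∈B} β(v₀)) / ‖v₀‖ = M such that for every v ∈ C \ {0}, one has (min_{β∈B} β(v)) / ‖v‖ = M if and only if v = c • v₀ for some real c > 0. -/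
namespace LinearMap

variable {E : Type*} [AddCommGroup E] [Module ℝ E]

/-- The minimum of finitely many linear functionals is superadditive. -/
theorem inf'_add_le_inf'_add (B : Finset (E →ₗ[ℝ] ℝ)) (hB : B.Nonempty) (u v : E) :
    (B.inf' hB fun β => β u) + (B.inf' hB fun β => β v) ≤ B.inf' hB fun β => β (u + v) := by
  refine Finset.le_inf' _ _ fun β hβ => ?_
  rw [map_add]
  exact add_le_add (Finset.inf'_le _ hβ) (Finset.inf'_le _ hβ)

/-- The minimum of finitely many linear functionals is positively homogeneous. -/
theorem inf'_smul_of_nonneg (B : Finset (E →ₗ[ℝ] ℝ)) (hB : B.Nonempty) {c : ℝ} (hc : 0 ≤ c)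
    (v : E) : (B.inf' hB fun β => β (c • v)) = c * B.inf' hB fun β => β v := by
  simp only [map_smul, smul_eq_mul]
  exact (Finset.apply_inf'_eq_inf'_comp hB (f := fun β : E →ₗ[ℝ] ℝ => β v) (c * ·)
    fun x y => mul_min_of_nonneg x y hc).symm

end LinearMap


/-- Kempf's convex-optimization lemma, part (ii): if the maximum `M` of
`v ↦ (min_{β ∈ B} β v) / ‖v‖` on `C \ {0}` is positive, then the set of
maximizers is a single ray. -/
theorem kempf_lemma_part_ii
    {E : Type*} [NormedAddCommGroup E] [InnerProductSpace ℝ E]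
    [FiniteDimensional ℝ E]
    (A B : Finset (E →ₗ[ℝ] ℝ)) (hB : B.Nonempty)
    (C : Set E) (hC : C = {v : E | ∀ α ∈ A, 0 ≤ α v})
    (hCne : ∃ v ∈ C, v ≠ 0)
    (M : ℝ)
    (hMub : ∀ v ∈ C, v ≠ 0 → (B.inf' hB fun β => β v) / ‖v‖ ≤ M)
    (hMmem : ∃ v ∈ C, v ≠ 0 ∧ (B.inf' hB fun β => β v) / ‖v‖ = M)
    (hMpos : 0 < M) :
    ∃ v₀ ∈ C, v₀ ≠ 0 ∧ (B.inf' hB fun β => β v₀) / ‖v₀‖ = M ∧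
      ∀ v ∈ C, v ≠ 0 →
        ((B.inf' hB fun β => β v) / ‖v‖ = M ↔ ∃ c : ℝ, 0 < c ∧ v = c • v₀) := by
  obtain ⟨u, huC, hu, huM⟩ := hMmem
  refine ⟨u, huC, hu, huM, fun v hvC hv => ⟨fun hvM => ?_, ?_⟩⟩
  · have hle : ∀ x ∈ C, (B.inf' hB fun β => β x) ≤ M * ‖x‖ := by
      intro x hx
      rcases eq_or_ne x 0 with rfl | hx0
      · simp
      · exact (div_le_iff₀ (norm_pos_iff.mpr hx0)).mp (hMub x hx hx0)
    have huvC : u + v ∈ C := by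
      subst hC
      intro α hα
      rw [map_add]
      exact add_nonneg (huC α hα) (hvC α hα)
    rw [div_eq_iff (norm_ne_zero_iff.mpr hu)] at huM
    rw [div_eq_iff (norm_ne_zero_iff.mpr hv)] at hvM
    have hnorm : ‖u‖ + ‖v‖ ≤ ‖u + v‖ := by
      refine le_of_mul_le_mul_left ?_ hMpos
      calc M * (‖u‖ + ‖v‖) = (B.inf' hB fun β => β u) + (B.inf' hB fun β => β v) := by
            rw [huM, hvM, mul_add]
        _ ≤ B.inf' hB fun β => β (u + v) := LinearMap.inf'_add_le_inf'_add B hB u v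
        _ ≤ M * ‖u + v‖ := hle _ huvC
    have hray : SameRay ℝ u v := sameRay_iff_norm_add.mpr (le_antisymm (norm_add_le u v) hnorm)
    obtain ⟨c, hc, h⟩ := hray.exists_pos_left hu hv
    exact ⟨c, hc, h.symm⟩
  · rintro ⟨c, hc, rfl⟩
    rw [LinearMap.inf'_smul_of_nonneg B hB hc.le, norm_smul, Real.norm_of_nonneg hc.le,
      mul_div_mul_left _ _ hc.ne', huM]
end

section
/- Let n be a natural number and let D be a finite set of linear functionals φ : (Fin n → ℝ) → ℝ such that each φ ∈ D takes rational values on vectors with rational coordinates (equivalently, φ applied to each standard basis vector is rational). Let C = {x ∈ Fin n → ℝ : φ(x) ≥ 0 for all φ ∈ D} be the closed convex cone defined by D. Then C is equal to the topological closure of the set of points of C all of whose coordinates are rational; that is, C = closure of {x ∈ C : x i ∈ ℚ for all i}. -/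
/-- The points with rational coordinates are dense in `ℝᵏ`. -/
theorem dense_setOf_rational_coordinates (ι : Type*) :
    Dense {t : ι → ℝ | ∀ j, ∃ q : ℚ, t j = q} := by
  have h : Dense (Set.univ.pi fun _ : ι => Set.range ((↑) : ℚ → ℝ)) :=
    dense_pi Set.univ fun _ _ => Rat.denseRange_cast
  refine h.mono fun t ht j => ?_
  obtain ⟨q, hq⟩ := ht j (Set.mem_univ j)
  exact ⟨q, hq.symm⟩

/-- Every real vector is a combination of finitely many rational vectors with coefficients
that are linearly independent over `ℚ`. -/
theorem exists_eq_sum_smul_rational {n : ℕ} (x : Fin n → ℝ) :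
    ∃ (k : ℕ) (w : Fin k → ℝ) (a : Fin k → Fin n → ℚ), LinearIndependent ℚ w ∧
      x = ∑ j, w j • fun i => (a j i : ℝ) := by
  let W := Submodule.span ℚ (Set.range x)
  have : Module.Finite ℚ W := Module.Finite.span_of_finite ℚ (Set.finite_range x)
  let b := Module.finBasis ℚ W
  let y : Fin n → W := fun i => ⟨x i, Submodule.subset_span ⟨i, rfl⟩⟩
  refine ⟨_, fun j => (b j : ℝ), fun j i => b.repr (y i) j,
    b.linearIndependent.map' W.subtype W.ker_subtype, ?_⟩
  ext i
  have h := congrArg W.subtype (b.sum_repr (y i))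
  rw [map_sum] at h
  simp only [map_smul, Submodule.subtype_apply, Rat.smul_def] at h
  simp only [Finset.sum_apply, Pi.smul_apply, smul_eq_mul]
  rw [← show ((y i : W) : ℝ) = x i from rfl, ← h]
  exact Finset.sum_congr rfl fun j _ => mul_comm _ _

/-- A polyhedral cone in `ℝⁿ` defined by finitely many linear functionals that
take rational values on rational vectors is the closure of its set of rational
points. -/
theorem polyhedral_cone_eq_closure_rational_points
    (n : ℕ) (D : Finset ((Fin n → ℝ) →ₗ[ℝ] ℝ))
    (hD : ∀ φ ∈ D, ∀ x : Fin n → ℝ, (∀ i, ∃ q : ℚ, x i = q) → ∃ q : ℚ, φ x = q)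
    (C : Set (Fin n → ℝ)) (hC : C = {x : Fin n → ℝ | ∀ φ ∈ D, 0 ≤ φ x}) :
    C = closure {x : Fin n → ℝ | x ∈ C ∧ ∀ i, ∃ q : ℚ, x i = q} := by
  have hcont (φ : (Fin n → ℝ) →ₗ[ℝ] ℝ) : Continuous φ := φ.continuous_of_finiteDimensional
  refine Set.Subset.antisymm (fun x hx => ?_) (closure_minimal (fun x hx => hx.1) ?_)
  · rw [hC] at hx
    obtain ⟨k, w, a, hw, hxw⟩ := exists_eq_sum_smul_rational x
    let f : (Fin k → ℝ) → Fin n → ℝ := fun t => ∑ j, t j • fun i => (a j i : ℝ)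
    have hf : Continuous f := by fun_prop
    have hfw : f w = x := hxw.symm
    have hφf (φ : (Fin n → ℝ) →ₗ[ℝ] ℝ) (t : Fin k → ℝ) :
        φ (f t) = ∑ j, t j * φ (fun i => (a j i : ℝ)) := by
      simp [f, map_sum]
    have hzero (φ) (hφ : φ ∈ D) (h0 : φ x = 0) (t : Fin k → ℝ) : φ (f t) = 0 := by
      choose c hc using fun j => hD φ hφ (fun i => (a j i : ℝ)) fun i => ⟨a j i, rfl⟩
      rw [← hfw, hφf] at h0
      have hc0 : ∀ j, c j = 0 := Fintype.linearIndependent_iff.1 hw c <| by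
        simpa only [Rat.smul_def, hc, mul_comm] using h0
      rw [hφf]
      simp [hc, hc0]
    let U : Set (Fin k → ℝ) := ⋂ φ ∈ D, {t | φ x ≠ 0 → 0 < φ (f t)}
    have hU : IsOpen U := isOpen_biInter_finset fun φ _ => by
      by_cases h : φ x = 0
      · simp [h]
      · simpa [h] using isOpen_lt continuous_const ((hcont φ).comp hf)
    have hwU : w ∈ U := Set.mem_iInter₂.2 fun φ hφ h => by
      rw [hfw]
      exact lt_of_le_of_ne (hx φ hφ) h.symm
    have hcl := (dense_setOf_rational_coordinates (Fin k)).open_subset_closure_inter hU hwU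
    rw [← hfw]
    refine map_mem_closure hf hcl fun t ⟨htU, ht⟩ => ⟨?_, fun i => ?_⟩
    · rw [hC]
      intro φ hφ
      by_cases h : φ x = 0
      · exact (hzero φ hφ h t).ge
      · exact (Set.mem_iInter₂.1 htU φ hφ h).le
    · choose q hq using ht
      exact ⟨∑ j, q j * a j i, by simp [f, hq]⟩
  · have hCi : C = ⋂ φ ∈ D, {x | 0 ≤ φ x} := by
      ext x
      simp [hC]
    rw [hCi]
    exact isClosed_biInter fun φ _ => isClosed_le continuous_const (hcont φ)
end
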